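/- Let G = (V,E) be a finite connected simple graph with edge weights (c_e)_{e∈E}, c_e > 0, such that 1 ≤ c_v := Σ_u c_{vu} ≤ D for all v ∈ V, and let (V,P,π) be the lazy random walk on this network. Let 0 < ε < 1 and A ⊆ V. Set ∂_V A := {a ∈ A : there exists b ∉ A with {a,b} ∈ E} and Ã := A ∖ ∂_V A, and assume π(Ã) ≥ 1 − ε/3. Let (A, P̃, π̃) be the lazy random walk on the induced network on A (same weights, restricted to edges with both endpoints in A), assume it is irreducible, and let c > 0 be its Cheeger constant. Set r := ⌈(2/c²)·log(3D|A|/(2ε))⌉. If x ∈ Ã satisfies P_x[T_{∂_V A} < r] ≤ ε/3 (for the lazy walk on the full network started at x), then ‖P^r(x,·) − π‖_TV ≤ ε. -/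

import Mathlib

open Filter Finset

noncomputable section

variable {V : Type} [Fintype V] [DecidableEq V]

/-- `P` is a row-stochastic matrix. -/
def IsStoch (P : Matrix V V ℝ) : Prop :=
  (∀ i j, 0 ≤ P i j) ∧ ∀ i, ∑ j, P i j = 1

/-- `π` is a probability vector with full support. -/
def IsProb (π : V → ℝ) : Prop := (∀ i, 0 < π i) ∧ ∑ i, π i = 1

/-- reversibility: `π x * P x y = π y * P y x`. -/
def Rev (P : Matrix V V ℝ) (π : V → ℝ) : Prop := ∀ i j, π i * P i j = π j * P j i

/-- irreducibility -/
def Irred (P : Matrix V V ℝ) : Prop := ∀ i j, ∃ t : ℕ, 0 < (P ^ t) i j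

/-- the lazy version `(I + P)/2` of a chain -/
def lazyM (P : Matrix V V ℝ) : Matrix V V ℝ := (2 : ℝ)⁻¹ • (1 + P)

/-- total variation distance -/
def tvDist (μ ν : V → ℝ) : ℝ := (∑ x, |μ x - ν x|) / 2

/-- worst-case total variation distance from stationarity at time `t` -/
def dTV (P : Matrix V V ℝ) (π : V → ℝ) (t : ℕ) : ℝ := ⨆ x, tvDist ((P ^ t) x) π

/-- the `ε` total-variation mixing time -/
def mixTime (P : Matrix V V ℝ) (π : V → ℝ) (ε : ℝ) : ℕ := sInf {t : ℕ | dTV P π t ≤ ε}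

/-- worst-case separation distance at time `t` -/
def dSep (P : Matrix V V ℝ) (π : V → ℝ) (t : ℕ) : ℝ := 1 - ⨅ x, ⨅ y, ((P ^ t) x y) / π y

/-- the `ε` separation time -/
def sepTime (P : Matrix V V ℝ) (π : V → ℝ) (ε : ℝ) : ℕ := sInf {t : ℕ | dSep P π t ≤ ε}

/-- the heat kernel `H_t = exp (t (P - I))` of the associated continuous-time chain -/
def heatKer (P : Matrix V V ℝ) (t : ℝ) : Matrix V V ℝ :=
  ∑' k : ℕ, (t ^ k / (Nat.factorial k : ℝ)) • ((P - 1) ^ k)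

/-- separation distance of the continuous-time chain -/
def dSepC (P : Matrix V V ℝ) (π : V → ℝ) (t : ℝ) : ℝ := 1 - ⨅ x, ⨅ y, (heatKer P t) x y / π y

/-- the `ε` separation time of the continuous-time chain -/
def sepTimeC (P : Matrix V V ℝ) (π : V → ℝ) (ε : ℝ) : ℝ := sInf {t : ℝ | 0 ≤ t ∧ dSepC P π t ≤ ε}

/-- degree of a vertex -/
def deg (G : SimpleGraph V) (v : V) : ℕ := Nat.card {u // G.Adj v u}

open Classical in
/-- transition matrix of the lazy simple random walk on `G` -/
def walkMat (G : SimpleGraph V) : Matrix V V ℝ :=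
  Matrix.of fun v u => if v = u then 1/2 else if G.Adj v u then 1 / (2 * (deg G v : ℝ)) else 0

/-- stationary distribution of the (lazy) simple random walk on `G` -/
def degSta (G : SimpleGraph V) (v : V) : ℝ := (deg G v : ℝ) / ∑ u, (deg G u : ℝ)

/-- the `ε` total-variation mixing time of the lazy simple random walk on `G` -/
def tmixG (G : SimpleGraph V) (ε : ℝ) : ℕ := mixTime (walkMat G) (degSta G) ε

/-- the second largest eigenvalue of a reversible transition matrix -/
def lam2 (P : Matrix V V ℝ) : ℝ :=
  sSup {μ : ℝ | μ ≠ 1 ∧ ∃ f : V → ℝ, f ≠ 0 ∧ P.mulVec f = μ • f}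

/-- the relaxation time `1/(1-λ₂)` -/
def trel (P : Matrix V V ℝ) : ℝ := 1 / (1 - lam2 P)

/-- the relaxation time of the lazy simple random walk on `G` -/
def trelG (G : SimpleGraph V) : ℝ := trel (walkMat G)

/-- transition matrix of the lazy random walk on the network with edge weights `w` -/
def wMat (w : V → V → ℝ) : Matrix V V ℝ :=
  Matrix.of fun v u => if v = u then 1/2 else w v u / (2 * ∑ x, w v x)

/-- stationary distribution of the lazy random walk on the network with edge weights `w` -/
def wSta (w : V → V → ℝ) (v : V) : ℝ := (∑ x, w v x) / ∑ u, ∑ x, w u x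

/-- `w` is a valid system of edge weights on the graph `G`: symmetric, positive on edges
and vanishing off the edges. -/
def GoodWeights (G : SimpleGraph V) (w : V → V → ℝ) : Prop :=
  (∀ u v, w u v = w v u) ∧ (∀ u v, G.Adj u v → 0 < w u v) ∧ ∀ u v, ¬ G.Adj u v → w u v = 0

/-- the `ε` total-variation mixing time of the lazy random walk on the weighted network -/
def tmixW (w : V → V → ℝ) (ε : ℝ) : ℕ := mixTime (wMat w) (wSta w) ε

/-- the probability of a discrete trajectory -/
def pathProb (P : Matrix V V ℝ) {k : ℕ} (w : Fin (k+1) → V) : ℝ :=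
  ∏ i : Fin k, P (w i.castSucc) (w i.succ)

/-- `P_x[T_y = k]`: probability that the chain started at `x` first hits `y` at time `k` -/
def firstHit (P : Matrix V V ℝ) (x y : V) (k : ℕ) : ℝ :=
  ∑ w : Fin (k+1) → V,
    if w 0 = x ∧ w (Fin.last k) = y ∧ ∀ i : Fin k, w i.castSucc ≠ y then pathProb P w else 0

/-- the restriction of `P - I` to the complement of `y` -/
def restrQ (P : Matrix V V ℝ) (y : V) : Matrix {w : V // w ≠ y} {w : V // w ≠ y} ℝ :=
  Matrix.of fun a b => P a.1 b.1 - if a = b then 1 else 0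

/-- `exp (t A)` where `A` is the restriction of `P - I` to the complement of `y` -/
def heatRestr (P : Matrix V V ℝ) (y : V) (t : ℝ) :
    Matrix {w : V // w ≠ y} {w : V // w ≠ y} ℝ :=
  ∑' k : ℕ, (t ^ k / (Nat.factorial k : ℝ)) • (restrQ P y ^ k)

/-- `P_x[T_B < r]` for the chain `P`: the probability that the set `B` is hit before time `r` -/
def hitByTime (P : Matrix V V ℝ) (B : Finset V) (x : V) (r : ℕ) : ℝ :=
  ∑ k ∈ Finset.range r, ∑ w : Fin (k+1) → V,
    if w 0 = x ∧ w (Fin.last k) ∈ B ∧ ∀ i : Fin k, w i.castSucc ∉ B then pathProb P w else 0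


/-- the Cheeger constant of a chain `(P, π)`:
`Φ = min {Q(S)/π(S) : 0 < π(S) ≤ 1/2}` where `Q(S) = Σ_{x ∈ S, y ∉ S} π(x) P(x,y)`. -/
def cheeger (P : Matrix V V ℝ) (π : V → ℝ) : ℝ :=
  sInf {r : ℝ | ∃ S : Finset V, 0 < ∑ v ∈ S, π v ∧ (∑ v ∈ S, π v) ≤ 1/2 ∧
    r = (∑ v ∈ S, ∑ u ∈ Sᶜ, π v * P v u) / ∑ v ∈ S, π v}

/-- transition matrix of the lazy random walk on the network induced on `A` -/
def indMat (w : V → V → ℝ) (A : Finset V) : Matrix {a // a ∈ A} {a // a ∈ A} ℝ :=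
  Matrix.of fun a b =>
    if a = b then 1/2 else w a.1 b.1 / (2 * ∑ b' : {a // a ∈ A}, w a.1 b'.1)

/-- stationary distribution of the lazy random walk on the network induced on `A` -/
def indSta (w : V → V → ℝ) (A : Finset V) : {a // a ∈ A} → ℝ :=
  fun a => (∑ b' : {a // a ∈ A}, w a.1 b'.1) /
    ∑ a' : {a // a ∈ A}, ∑ b' : {a // a ∈ A}, w a'.1 b'.1

section Network

variable {w : V → V → ℝ}

lemma sum_mul_abs_indicator_sub (hs : ∀ u v, w u v = w v u) (S : Finset V) :
    ∑ u, ∑ v, w u v * |(if u ∈ S then (1 : ℝ) else 0) - if v ∈ S then 1 else 0| =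
      2 * ∑ v ∈ S, ∑ u ∈ Sᶜ, w v u := by
  have hcut : ∑ v ∈ S, ∑ u ∈ Sᶜ, w v u =
      ∑ u, ∑ v, if u ∈ S ∧ v ∉ S then w u v else 0 := by
    rw [← Finset.sum_filter_add_sum_filter_not univ (· ∈ S)
      (fun u => ∑ v, if u ∈ S ∧ v ∉ S then w u v else 0)]
    have h0 : ∑ u with ¬ u ∈ S, ∑ v, (if u ∈ S ∧ v ∉ S then w u v else 0) = 0 := by
      refine Finset.sum_eq_zero fun u hu => Finset.sum_eq_zero fun v _ => ?_
      simp only [mem_filter, mem_univ, true_and] at hu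
      simp [hu]
    rw [h0, add_zero, Finset.filter_mem_eq_inter, Finset.univ_inter]
    refine Finset.sum_congr rfl fun u hu => ?_
    simp only [hu, true_and]
    rw [← Finset.sum_filter]
    congr 1
    ext v
    simp
  have hswap : ∑ u, ∑ v, (if u ∈ S ∧ v ∉ S then w u v else 0) =
      ∑ u, ∑ v, if v ∈ S ∧ u ∉ S then w u v else 0 := by
    rw [Finset.sum_comm]
    refine Finset.sum_congr rfl fun u _ => Finset.sum_congr rfl fun v _ => ?_
    rw [hs]
  rw [two_mul, hcut]
  nth_rewrite 2 [hswap]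
  simp only [← Finset.sum_add_distrib]
  refine Finset.sum_congr rfl fun u _ => Finset.sum_congr rfl fun v _ => ?_
  by_cases hu : u ∈ S <;> by_cases hv : v ∈ S <;> simp [hu, hv]

/-- The discrete coarea inequality: an isoperimetric inequality for sets of volume at most `m`
gives an `ℓ¹` Poincaré inequality for functions whose support has volume at most `m`. -/
lemma coarea_le (hs : ∀ u v, w u v = w v u) (hnn : ∀ u v, 0 ≤ w u v) {h m : ℝ}
    (hiso : ∀ S : Finset V, ∑ v ∈ S, ∑ u, w v u ≤ m →
      h * ∑ v ∈ S, ∑ u, w v u ≤ ∑ v ∈ S, ∑ u ∈ Sᶜ, w v u)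
    (F : V → ℝ) (hF : ∀ v, 0 ≤ F v) (hm : ∑ v with F v ≠ 0, ∑ u, w v u ≤ m) :
    2 * h * ∑ v, (∑ u, w v u) * F v ≤ ∑ u, ∑ v, w u v * |F u - F v| := by
  induction hn : #{v | F v ≠ 0} using Nat.strong_induction_on generalizing F with
  | _ n ih =>
  set S : Finset V := {v | F v ≠ 0} with hS
  have memS : ∀ v, v ∈ S ↔ F v ≠ 0 := fun v => by simp [hS]
  rcases S.eq_empty_or_nonempty with hE | hne
  · have hz : ∀ v, F v = 0 := fun v => by
      by_contra hv
      have := (memS v).2 hv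
      simp [hE] at this
    simp [hz]
  · obtain ⟨a, haS, hmin⟩ := Finset.exists_min_image S F hne
    have hta : 0 < F a := lt_of_le_of_ne (hF a) (Ne.symm ((memS a).1 haS))
    set F' : V → ℝ := fun v => if v ∈ S then F v - F a else 0 with hF'
    have hsub : ({v | F' v ≠ 0} : Finset V) ⊆ S := fun v hv => by
      simp only [mem_filter, mem_univ, true_and, hF'] at hv
      by_contra hvS
      simp [hvS] at hv
    have hssub : ({v | F' v ≠ 0} : Finset V) ⊂ S :=
      (Finset.ssubset_iff_of_subset hsub).2 ⟨a, haS, by simp [hF']⟩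
    have hF'nn : ∀ v, 0 ≤ F' v := fun v => by
      simp only [hF']
      split_ifs with hv
      · linarith [hmin v hv]
      · exact le_rfl
    have key := ih _ (hn ▸ Finset.card_lt_card hssub) F' hF'nn
      (le_trans (Finset.sum_le_sum_of_subset_of_nonneg hsub fun v _ _ =>
        Finset.sum_nonneg fun u _ => hnn v u) hm) rfl
    have hdec : ∀ v, F v = F' v + F a * (if v ∈ S then 1 else 0) := fun v => by
      by_cases hv : v ∈ S
      · simp [hF', hv]
      · have : F v = 0 := by
          by_contra h0
          exact hv ((memS v).2 h0)
        simp [hF', hv, this]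
    have habs : ∀ u v, |F u - F v| = |F' u - F' v| +
        F a * |(if u ∈ S then (1 : ℝ) else 0) - if v ∈ S then 1 else 0| := fun u v => by
      rw [hdec u, hdec v]
      have h1 := hF'nn u
      have h2 := hF'nn v
      by_cases hu : u ∈ S <;> by_cases hv : v ∈ S
      · simp [hu, hv]
      · have : F' v = 0 := by simp [hF', hv]
        simp only [hu, hv, this, if_true, if_false]
        norm_num
        rw [abs_of_nonneg h1, abs_of_nonneg (by linarith)]
      · have : F' u = 0 := by simp [hF', hu]
        simp only [hu, hv, this, if_true, if_false]
        norm_num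
        rw [abs_of_nonneg h2, abs_of_nonpos (by linarith)]
        ring
      · simp [hu, hv]
    have hL : ∑ v, (∑ u, w v u) * F v =
        ∑ v, (∑ u, w v u) * F' v + F a * ∑ v ∈ S, ∑ u, w v u := by
      rw [Finset.mul_sum, ← Finset.sum_filter_add_sum_filter_not univ (· ∈ S)
        (fun v => (∑ u, w v u) * F v), ← Finset.sum_filter_add_sum_filter_not univ (· ∈ S)
        (fun v => (∑ u, w v u) * F' v)]
      have e1 : ∑ v with v ∉ S, (∑ u, w v u) * F v = ∑ v with v ∉ S, (∑ u, w v u) * F' v := by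
        refine Finset.sum_congr rfl fun v hv => ?_
        simp only [mem_filter, mem_univ, true_and] at hv
        rw [hdec v]
        simp [hv]
      have e2 : ∑ v with v ∈ S, (∑ u, w v u) * F v =
          ∑ v with v ∈ S, (∑ u, w v u) * F' v + ∑ v ∈ S, F a * ∑ u, w v u := by
        rw [Finset.filter_mem_eq_inter, Finset.univ_inter, ← Finset.sum_add_distrib]
        refine Finset.sum_congr rfl fun v hv => ?_
        rw [hdec v]
        simp only [hv, if_true]
        ring
      rw [e1, e2]
      ring
    have hR : ∑ u, ∑ v, w u v * |F u - F v| = ∑ u, ∑ v, w u v * |F' u - F' v| +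
        F a * (2 * ∑ v ∈ S, ∑ u ∈ Sᶜ, w v u) := by
      rw [← sum_mul_abs_indicator_sub hs, Finset.mul_sum, ← Finset.sum_add_distrib]
      refine Finset.sum_congr rfl fun u _ => ?_
      rw [Finset.mul_sum, ← Finset.sum_add_distrib]
      refine Finset.sum_congr rfl fun v _ => ?_
      rw [habs]
      ring
    have := mul_le_mul_of_nonneg_left (hiso S hm) hta.le
    rw [hL, hR]
    nlinarith

lemma sum_sum_mul_right {ι : Type*} [Fintype ι] {w : ι → ι → ℝ} (hs : ∀ u v, w u v = w v u)
    (f : ι → ℝ) :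
    ∑ v, ∑ u, w v u * f u = ∑ v, (∑ u, w v u) * f v := by
  rw [Finset.sum_comm]
  refine Finset.sum_congr rfl fun v _ => ?_
  rw [Finset.sum_mul]
  exact Finset.sum_congr rfl fun u _ => by rw [hs]

/-- Cheeger's inequality for nonnegative functions with small support. -/
lemma sq_mul_le_energy_of_nonneg (hs : ∀ u v, w u v = w v u) (hnn : ∀ u v, 0 ≤ w u v) {h m : ℝ}
    (hh : 0 ≤ h)
    (hiso : ∀ S : Finset V, ∑ v ∈ S, ∑ u, w v u ≤ m →
      h * ∑ v ∈ S, ∑ u, w v u ≤ ∑ v ∈ S, ∑ u ∈ Sᶜ, w v u)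
    (g : V → ℝ) (hg : ∀ v, 0 ≤ g v) (hm : ∑ v with g v ≠ 0, ∑ u, w v u ≤ m) :
    h ^ 2 * ∑ v, (∑ u, w v u) * g v ^ 2 ≤ ∑ u, ∑ v, w u v * (g u - g v) ^ 2 := by
  have hco := coarea_le hs hnn hiso (fun v => g v ^ 2) (fun v => sq_nonneg _) (by simpa using hm)
  have hpt : ∀ u v, h * (w u v * |g u ^ 2 - g v ^ 2|) ≤
      w u v * (g u - g v) ^ 2 + h ^ 2 / 2 * (w u v * g u ^ 2 + w u v * g v ^ 2) := fun u v => by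
    have h1 : |g u ^ 2 - g v ^ 2| = |g u - g v| * (g u + g v) := by
      rw [sq_sub_sq, abs_mul, abs_of_nonneg (add_nonneg (hg u) (hg v)), mul_comm]
    have h2 : h * |g u ^ 2 - g v ^ 2| ≤
        (g u - g v) ^ 2 + h ^ 2 / 2 * (g u ^ 2 + g v ^ 2) := by
      rw [h1, ← sq_abs (g u - g v)]
      have h3 : |g u - g v| ^ 2 = (g u - g v) ^ 2 := sq_abs _
      nlinarith [sq_nonneg (|g u - g v| - h / 2 * (g u + g v)),
        mul_nonneg (sq_nonneg h) (sq_nonneg (g u - g v))]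
    nlinarith [mul_le_mul_of_nonneg_left h2 (hnn u v)]
  have hsum := Finset.sum_le_sum fun u (_ : u ∈ univ) =>
    Finset.sum_le_sum fun v (_ : v ∈ univ) => hpt u v
  simp only [Finset.sum_add_distrib, ← Finset.mul_sum, sum_sum_mul_right hs] at hsum
  simp only [← Finset.sum_mul] at hsum
  nlinarith [mul_le_mul_of_nonneg_left hco hh]

lemma exists_median {ι : Type*} [Fintype ι] [Nonempty ι] {d : ι → ℝ} (hd : ∀ v, 0 ≤ d v)
    (f : ι → ℝ) :
    ∃ m : ℝ, ∑ v with m < f v, d v ≤ (∑ v, d v) / 2 ∧ ∑ v with f v < m, d v ≤ (∑ v, d v) / 2 := by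
  classical
  set T : Finset ι := {a | ∑ v with f a < f v, d v ≤ (∑ v, d v) / 2} with hT
  have hne : T.Nonempty := by
    obtain ⟨a, -, ha⟩ := Finset.exists_max_image univ f Finset.univ_nonempty
    refine ⟨a, ?_⟩
    have : ({v | f a < f v} : Finset ι) = ∅ := by
      ext v
      simpa using ha v (mem_univ v)
    simp only [hT, mem_filter, mem_univ, true_and, this, Finset.sum_empty]
    exact div_nonneg (Finset.sum_nonneg fun v _ => hd v) two_pos.le
  obtain ⟨a, haT, hmin⟩ := Finset.exists_min_image T f hne
  refine ⟨f a, by simpa [hT] using haT, ?_⟩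
  rcases ({v | f v < f a} : Finset ι).eq_empty_or_nonempty with hE | hne'
  · rw [hE, Finset.sum_empty]
    exact div_nonneg (Finset.sum_nonneg fun v _ => hd v) two_pos.le
  · obtain ⟨b, hb, hmax⟩ := Finset.exists_max_image _ f hne'
    simp only [mem_filter, mem_univ, true_and] at hb hmax
    have hbT : ¬ ∑ v with f b < f v, d v ≤ (∑ v, d v) / 2 := fun hle => by
      have : b ∈ T := by simpa [hT] using hle
      exact absurd (hmin b this) (not_le.2 hb)
    have hsplit := Finset.sum_filter_add_sum_filter_not univ (fun v => f b < f v) d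
    have hle : ∑ v with f v < f a, d v ≤ ∑ v with ¬ f b < f v, d v := by
      refine Finset.sum_le_sum_of_subset_of_nonneg (fun v hv => ?_) fun v _ _ => hd v
      simp only [mem_filter, mem_univ, true_and] at hv ⊢
      exact not_lt.2 (hmax v hv)
    linarith

/-- Cheeger's inequality for functions of mean zero. -/
lemma sq_mul_le_energy (hs : ∀ u v, w u v = w v u) (hnn : ∀ u v, 0 ≤ w u v) [Nonempty V] {h : ℝ}
    (hh : 0 ≤ h)
    (hiso : ∀ S : Finset V, ∑ v ∈ S, ∑ u, w v u ≤ (∑ v, ∑ u, w v u) / 2 →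
      h * ∑ v ∈ S, ∑ u, w v u ≤ ∑ v ∈ S, ∑ u ∈ Sᶜ, w v u)
    (f : V → ℝ) (hf : ∑ v, (∑ u, w v u) * f v = 0) :
    h ^ 2 * ∑ v, (∑ u, w v u) * f v ^ 2 ≤ ∑ u, ∑ v, w u v * (f u - f v) ^ 2 := by
  have hd : ∀ v, 0 ≤ ∑ u, w v u := fun v => Finset.sum_nonneg fun u _ => hnn v u
  obtain ⟨m, hm1, hm2⟩ := exists_median hd f
  have hpos := sq_mul_le_energy_of_nonneg hs hnn hh hiso (fun v => max (f v - m) 0)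
    (fun v => le_max_right _ _) (by simpa using hm1)
  have hneg := sq_mul_le_energy_of_nonneg hs hnn hh hiso (fun v => max (m - f v) 0)
    (fun v => le_max_right _ _) (by simpa using hm2)
  have hE : ∑ u, ∑ v, w u v * (max (f u - m) 0 - max (f v - m) 0) ^ 2 +
      ∑ u, ∑ v, w u v * (max (m - f u) 0 - max (m - f v) 0) ^ 2 ≤
      ∑ u, ∑ v, w u v * (f u - f v) ^ 2 := by
    simp only [← Finset.sum_add_distrib, ← mul_add]
    refine Finset.sum_le_sum fun u _ => Finset.sum_le_sum fun v _ =>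
      mul_le_mul_of_nonneg_left ?_ (hnn u v)
    rcases le_total (f u) m with h1 | h1 <;> rcases le_total (f v) m with h2 | h2
    · rw [max_eq_right (sub_nonpos.2 h1), max_eq_right (sub_nonpos.2 h2),
        max_eq_left (sub_nonneg.2 h1), max_eq_left (sub_nonneg.2 h2)]
      nlinarith
    · rw [max_eq_right (sub_nonpos.2 h1), max_eq_left (sub_nonneg.2 h2),
        max_eq_left (sub_nonneg.2 h1), max_eq_right (sub_nonpos.2 h2)]
      nlinarith
    · rw [max_eq_left (sub_nonneg.2 h1), max_eq_right (sub_nonpos.2 h2),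
        max_eq_right (sub_nonpos.2 h1), max_eq_left (sub_nonneg.2 h2)]
      nlinarith
    · rw [max_eq_left (sub_nonneg.2 h1), max_eq_left (sub_nonneg.2 h2),
        max_eq_right (sub_nonpos.2 h1), max_eq_right (sub_nonpos.2 h2)]
      nlinarith
  have hN : ∑ v, (∑ u, w v u) * f v ^ 2 ≤ ∑ v, (∑ u, w v u) * max (f v - m) 0 ^ 2 +
      ∑ v, (∑ u, w v u) * max (m - f v) 0 ^ 2 := by
    have hsq : ∀ v, (∑ u, w v u) * max (f v - m) 0 ^ 2 + (∑ u, w v u) * max (m - f v) 0 ^ 2 =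
        (∑ u, w v u) * f v ^ 2 - 2 * m * ((∑ u, w v u) * f v) + (∑ u, w v u) * m ^ 2 := fun v => by
      rcases le_total (f v) m with h1 | h1
      · rw [max_eq_right (sub_nonpos.2 h1), max_eq_left (sub_nonneg.2 h1)]
        ring
      · rw [max_eq_left (sub_nonneg.2 h1), max_eq_right (sub_nonpos.2 h1)]
        ring
    rw [← Finset.sum_add_distrib, Finset.sum_congr rfl fun v _ => hsq v, Finset.sum_add_distrib,
      Finset.sum_sub_distrib, ← Finset.mul_sum, hf]
    have : 0 ≤ ∑ v, (∑ u, w v u) * m ^ 2 :=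
      Finset.sum_nonneg fun v _ => mul_nonneg (hd v) (sq_nonneg _)
    linarith
  nlinarith [mul_le_mul_of_nonneg_left hN (sq_nonneg h)]

lemma wMat_mulVec (hl : ∀ v, w v v = 0) (f : V → ℝ) (v : V) :
    (wMat w).mulVec f v = (f v + (∑ u, w v u * f u) / ∑ u, w v u) / 2 := by
  have hterm : ∀ u, wMat w v u * f u =
      (if v = u then f u / 2 else 0) + w v u * f u * (2 * ∑ x, w v x)⁻¹ := fun u => by
    by_cases h : v = u
    · subst h
      simp [wMat, hl]
      ring
    · simp [wMat, h]
      ring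
  rw [Matrix.mulVec, dotProduct, Finset.sum_congr rfl fun u _ => hterm u,
    Finset.sum_add_distrib, Finset.sum_ite_eq, ← Finset.sum_mul, mul_inv]
  simp only [mem_univ, if_true]
  ring

lemma isStoch_wMat (hnn : ∀ u v, 0 ≤ w u v) (hl : ∀ v, w v v = 0) (hd : ∀ v, 0 < ∑ u, w v u) :
    IsStoch (wMat w) := by
  constructor
  · intro i j
    simp only [wMat, Matrix.of_apply]
    split_ifs
    · norm_num
    · exact div_nonneg (hnn i j) (mul_nonneg two_pos.le (hd i).le)
  · intro i
    have := wMat_mulVec hl (fun _ => (1 : ℝ)) i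
    simp only [Matrix.mulVec, dotProduct, mul_one, div_self (hd i).ne'] at this
    rw [this]
    norm_num

lemma rev_wMat (hs : ∀ u v, w u v = w v u) (hd : ∀ v, 0 < ∑ u, w v u) :
    Rev (wMat w) (fun v => ∑ u, w v u) := by
  intro i j
  by_cases h : i = j
  · subst h
    rfl
  · have h1 := (hd i).ne'
    have h2 := (hd j).ne'
    simp only [wMat, Matrix.of_apply, h, Ne.symm h, if_false]
    rw [hs j i]
    field_simp

lemma Rev.pow {P : Matrix V V ℝ} {π : V → ℝ} (h : Rev P π) (t : ℕ) : Rev (P ^ t) π := by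
  induction t with
  | zero =>
    intro i j
    by_cases hij : i = j
    · subst hij
      rfl
    · simp [hij, Ne.symm hij]
  | succ t ih =>
    intro i j
    rw [pow_succ, Matrix.mul_apply, ← pow_succ, pow_succ', Matrix.mul_apply, Finset.mul_sum,
      Finset.mul_sum]
    refine Finset.sum_congr rfl fun k _ => ?_
    rw [← mul_assoc, ih i k, mul_right_comm, h k j]
    ring

lemma IsStoch.pow {P : Matrix V V ℝ} (h : IsStoch P) (t : ℕ) : IsStoch (P ^ t) := by
  induction t with
  | zero =>
    refine ⟨fun i j => ?_, fun i => ?_⟩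
    · rw [pow_zero, Matrix.one_apply]
      split_ifs <;> norm_num
    · simp [Matrix.one_apply]
  | succ t ih =>
    refine ⟨fun i j => ?_, fun i => ?_⟩
    · rw [pow_succ, Matrix.mul_apply]
      exact Finset.sum_nonneg fun k _ => mul_nonneg (ih.1 i k) (h.1 k j)
    · simp only [pow_succ, Matrix.mul_apply]
      rw [Finset.sum_comm]
      simp only [← Finset.mul_sum, h.2, mul_one, ih.2]

/-- One step of the lazy walk decreases the `ℓ²` norm by at least a quarter of the energy. -/
lemma sum_wMat_mulVec_sq_le (hs : ∀ u v, w u v = w v u) (hnn : ∀ u v, 0 ≤ w u v)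
    (hl : ∀ v, w v v = 0) (hd : ∀ v, 0 < ∑ u, w v u) (f : V → ℝ) :
    ∑ v, (∑ u, w v u) * (wMat w).mulVec f v ^ 2 ≤
      ∑ v, (∑ u, w v u) * f v ^ 2 - (∑ u, ∑ v, w u v * (f u - f v) ^ 2) / 4 := by
  have hpt : ∀ v, (∑ u, w v u) * (wMat w).mulVec f v ^ 2 ≤
      (∑ u, w v u) * f v ^ 2 / 2 + (∑ u, w v u * f u ^ 2) / 2 -
        (∑ u, w v u * (f v - f u) ^ 2) / 4 := fun v => by
    have hE : ∑ u, w v u * (f v - f u) ^ 2 = (∑ u, w v u) * f v ^ 2 -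
        2 * f v * (∑ u, w v u * f u) + ∑ u, w v u * f u ^ 2 := by
      rw [Finset.sum_mul, Finset.mul_sum, ← Finset.sum_sub_distrib, ← Finset.sum_add_distrib]
      exact Finset.sum_congr rfl fun u _ => by ring
    have hCS : (∑ u, w v u * f u) ^ 2 ≤ (∑ u, w v u) * ∑ u, w v u * f u ^ 2 :=
      Finset.sum_sq_le_sum_mul_sum_of_sq_le_mul univ (fun u _ => hnn v u)
        (fun u _ => mul_nonneg (hnn v u) (sq_nonneg _)) fun u _ => le_of_eq (by ring)
    rw [wMat_mulVec hl, hE]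
    have hdv := hd v
    set d := ∑ u, w v u
    set s := ∑ u, w v u * f u
    set q := ∑ u, w v u * f u ^ 2
    have h1 : s ^ 2 / d ≤ q := by
      rw [div_le_iff₀ hdv]
      linarith
    have h2 : d * ((f v + s / d) / 2) ^ 2 = (d * f v ^ 2 + 2 * f v * s + s ^ 2 / d) / 4 := by
      field_simp
      ring
    rw [h2]
    linarith
  refine (Finset.sum_le_sum fun v _ => hpt v).trans (le_of_eq ?_)
  rw [Finset.sum_sub_distrib, Finset.sum_add_distrib]
  simp only [← Finset.sum_div, sum_sum_mul_right hs]
  ring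

/-- Exponential `ℓ¹` convergence of the lazy walk from an isoperimetric inequality. -/
lemma sum_abs_pow_sub_sq_le (hs : ∀ u v, w u v = w v u) (hnn : ∀ u v, 0 ≤ w u v)
    (hl : ∀ v, w v v = 0) (hd : ∀ v, 0 < ∑ u, w v u) {c : ℝ} (hc : 0 ≤ c)
    (hiso : ∀ S : Finset V, ∑ v ∈ S, ∑ u, w v u ≤ (∑ v, ∑ u, w v u) / 2 →
      2 * c * ∑ v ∈ S, ∑ u, w v u ≤ ∑ v ∈ S, ∑ u ∈ Sᶜ, w v u) (x : V) (t : ℕ) :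
    (∑ y, |(wMat w ^ t) x y - wSta w y|) ^ 2 ≤
      (∑ v, ∑ u, w v u) / (∑ u, w x u) * Real.exp (-(c ^ 2 * t)) := by
  have : Nonempty V := ⟨x⟩
  have hM : 0 < ∑ v, ∑ u, w v u := Finset.sum_pos (fun v _ => hd v) Finset.univ_nonempty
  have hst := isStoch_wMat hnn hl hd
  have hrev := rev_wMat hs hd
  set M := ∑ v, ∑ u, w v u with hMdef
  set f : ℕ → V → ℝ := fun t y => (wMat w ^ t) y x - (∑ u, w x u) / M with hf
  have hmean : ∀ t, ∑ v, (∑ u, w v u) * f t v = 0 := fun t => by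
    simp only [hf, mul_sub, Finset.sum_sub_distrib]
    rw [← Finset.sum_mul, Finset.sum_congr rfl fun v _ => hrev.pow t v x, ← Finset.mul_sum,
      (hst.pow t).2, ← hMdef]
    field_simp
    ring
  have hstep : ∀ t, f (t + 1) = (wMat w).mulVec (f t) := fun t => by
    funext y
    simp only [hf, Matrix.mulVec, dotProduct, mul_sub, Finset.sum_sub_distrib]
    rw [← Finset.sum_mul, hst.2, one_mul, pow_succ', Matrix.mul_apply]
  have hdecay : ∀ t : ℕ, ∑ v, (∑ u, w v u) * f t v ^ 2 ≤
      (∑ u, w x u) * Real.exp (-(c ^ 2 * t)) := fun t => by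
    induction t with
    | zero =>
      have h1 : ∀ v, (∑ u, w v u) * f 0 v ^ 2 = (if v = x then ∑ u, w v u else 0) -
          (∑ u, w x u) / M * ((∑ u, w v u) * f 0 v) -
          (if v = x then (∑ u, w v u) * ((∑ u, w x u) / M) else 0) := fun v => by
        by_cases hv : v = x
        · subst hv
          simp [hf]
          ring
        · simp [hf, hv]
          ring
      rw [Finset.sum_congr rfl fun v _ => h1 v, Finset.sum_sub_distrib, Finset.sum_sub_distrib,
        ← Finset.mul_sum, hmean, Finset.sum_ite_eq', Finset.sum_ite_eq']
      have : 0 ≤ (∑ u, w x u) * ((∑ u, w x u) / M) :=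
        mul_nonneg (hd x).le (div_nonneg (hd x).le hM.le)
      simp
      linarith
    | succ t ih =>
      rw [hstep]
      have h1 := sum_wMat_mulVec_sq_le hs hnn hl hd (f t)
      have h2 := sq_mul_le_energy hs hnn (mul_nonneg two_pos.le hc) hiso (f t) (hmean t)
      have h3 : 1 - c ^ 2 ≤ Real.exp (-c ^ 2) := by
        linarith [Real.add_one_le_exp (-c ^ 2)]
      have h4 : 0 ≤ ∑ v, (∑ u, w v u) * f t v ^ 2 :=
        Finset.sum_nonneg fun v _ => mul_nonneg (hd v).le (sq_nonneg _)
      have h5 : Real.exp (-(c ^ 2 * ((t + 1 : ℕ) : ℝ))) =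
          Real.exp (-c ^ 2) * Real.exp (-(c ^ 2 * t)) := by
        rw [← Real.exp_add]
        push_cast
        ring_nf
      rw [h5]
      nlinarith [mul_le_mul_of_nonneg_right h3 h4,
        mul_le_mul_of_nonneg_left ih (Real.exp_pos (-c ^ 2)).le]
  have habs : ∀ y, |(wMat w ^ t) x y - wSta w y| = (∑ u, w y u) * |f t y| / ∑ u, w x u := by
    intro y
    have h1 : (wMat w ^ t) x y - wSta w y = (∑ u, w y u) * f t y / ∑ u, w x u := by
      rw [eq_div_iff (hd x).ne', mul_comm, mul_sub, hrev.pow t x y]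
      simp only [hf, wSta, ← hMdef]
      ring
    rw [h1, abs_div, abs_mul, abs_of_pos (hd y), abs_of_pos (hd x)]
  have hCS : (∑ y, (∑ u, w y u) * |f t y|) ^ 2 ≤ M * ∑ y, (∑ u, w y u) * f t y ^ 2 :=
    Finset.sum_sq_le_sum_mul_sum_of_sq_le_mul univ (fun u _ => (hd u).le)
      (fun u _ => mul_nonneg (hd u).le (sq_nonneg _)) fun u _ =>
        le_of_eq (by rw [mul_pow, sq_abs]; ring)
  rw [Finset.sum_congr rfl fun y _ => habs y, ← Finset.sum_div, div_pow,
    div_le_iff₀ (pow_pos (hd x) 2)]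
  have h1 := hCS.trans (mul_le_mul_of_nonneg_left (hdecay t) hM.le)
  refine h1.trans (le_of_eq ?_)
  have := (hd x).ne'
  field_simp

/-- Reading off the isoperimetric inequality of a network from its Cheeger constant. -/
lemma cheeger_isoperimetric (hnn : ∀ u v, 0 ≤ w u v) (hd : ∀ v, 0 < ∑ u, w v u) (S : Finset V)
    (hS : ∑ v ∈ S, ∑ u, w v u ≤ (∑ v, ∑ u, w v u) / 2) :
    2 * cheeger (wMat w) (wSta w) * ∑ v ∈ S, ∑ u, w v u ≤ ∑ v ∈ S, ∑ u ∈ Sᶜ, w v u := by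
  rcases S.eq_empty_or_nonempty with rfl | hne
  · simp
  obtain ⟨x, -⟩ := id hne
  have : Nonempty V := ⟨x⟩
  have hM : 0 < ∑ v, ∑ u, w v u := Finset.sum_pos (fun v _ => hd v) Finset.univ_nonempty
  have hSpos : 0 < ∑ v ∈ S, ∑ u, w v u := Finset.sum_pos (fun v _ => hd v) hne
  have hπ : ∑ v ∈ S, wSta w v = (∑ v ∈ S, ∑ u, w v u) / ∑ v, ∑ u, w v u := by
    simp only [wSta, Finset.sum_div]
  have hsta : ∀ v, 0 ≤ wSta w v := fun v => div_nonneg (hd v).le hM.le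
  have hP : ∀ v u, 0 ≤ wMat w v u := fun v u => by
    simp only [wMat, Matrix.of_apply]
    split_ifs
    · norm_num
    · exact div_nonneg (hnn v u) (mul_nonneg two_pos.le (hd v).le)
  have hQ : ∑ v ∈ S, ∑ u ∈ Sᶜ, wSta w v * wMat w v u =
      (∑ v ∈ S, ∑ u ∈ Sᶜ, w v u) / (2 * ∑ v, ∑ u, w v u) := by
    rw [Finset.sum_div]
    refine Finset.sum_congr rfl fun v hv => ?_
    rw [Finset.sum_div]
    refine Finset.sum_congr rfl fun u hu => ?_
    have hne : v ≠ u := fun h => Finset.mem_compl.1 hu (h ▸ hv)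
    have := (hd v).ne'
    simp only [wSta, wMat, Matrix.of_apply, hne, if_false]
    field_simp
  have hle : cheeger (wMat w) (wSta w) ≤
      (∑ v ∈ S, ∑ u ∈ Sᶜ, wSta w v * wMat w v u) / ∑ v ∈ S, wSta w v := by
    refine csInf_le ⟨0, ?_⟩ ⟨S, ?_, ?_, rfl⟩
    · rintro _ ⟨T, -, -, rfl⟩
      exact div_nonneg (Finset.sum_nonneg fun v _ => Finset.sum_nonneg fun u _ =>
        mul_nonneg (hsta v) (hP v u)) (Finset.sum_nonneg fun v _ => hsta v)
    · rw [hπ]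
      exact div_pos hSpos hM
    · rw [hπ, div_le_iff₀ hM]
      linarith
  rw [hQ, hπ, div_div_div_eq, le_div_iff₀ (by positivity)] at hle
  have : (2 * cheeger (wMat w) (wSta w) * ∑ v ∈ S, ∑ u, w v u) * ∑ v, ∑ u, w v u ≤
      (∑ v ∈ S, ∑ u ∈ Sᶜ, w v u) * ∑ v, ∑ u, w v u := by linarith
  exact le_of_mul_le_mul_right this hM

/-- In an irreducible network with an edge there is no isolated vertex. -/
lemma sum_pos_of_irred (hnn : ∀ u v, 0 ≤ w u v) (hirr : Irred (wMat w)) {x : V}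
    (hx : 0 < ∑ u, w x u) (v : V) : 0 < ∑ u, w v u := by
  refine lt_of_le_of_ne (Finset.sum_nonneg fun u _ => hnn v u) fun h0 => ?_
  have hvx : v ≠ x := fun h => by
    subst h
    exact hx.ne h0
  have hrow : ∀ u, v ≠ u → wMat w v u = 0 := fun u hu => by
    simp [wMat, hu, ← h0]
  have hz : ∀ t, (wMat w ^ t) v x = 0 := fun t => by
    induction t with
    | zero => simp [hvx]
    | succ t ih =>
      rw [pow_succ', Matrix.mul_apply]
      refine Finset.sum_eq_zero fun u _ => ?_
      by_cases hu : v = u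
      · rw [← hu, ih, mul_zero]
      · rw [hrow u hu, zero_mul]
  obtain ⟨t, ht⟩ := hirr v x
  exact ht.ne' (hz t)

end Network

section Killing

/-- The chain `P` killed when it leaves a state of `B`. -/
def killed (P : Matrix V V ℝ) (B : Finset V) : Matrix V V ℝ :=
  Matrix.of fun a b => if a ∈ B then 0 else P a b

lemma pathProb_killed {ι : Type} [DecidableEq ι] (P : Matrix ι ι ℝ) (B : Finset ι) {k : ℕ}
    (p : Fin (k + 1) → ι) :
    pathProb (killed P B) p = if ∀ i : Fin k, p i.castSucc ∉ B then pathProb P p else 0 := by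
  unfold pathProb
  split_ifs with h
  · exact Finset.prod_congr rfl fun i _ => by simp [killed, h i]
  · push Not at h
    obtain ⟨i, hi⟩ := h
    exact Finset.prod_eq_zero (mem_univ i) (by simp [killed, hi])

lemma sum_pathProb (P : Matrix V V ℝ) (g : V → ℝ) (k : ℕ) (x : V) :
    ∑ p : Fin (k + 1) → V, (if p 0 = x then pathProb P p * g (p (Fin.last k)) else 0) =
      (P ^ k).mulVec g x := by
  induction k generalizing x with
  | zero =>
    rw [pow_zero, Matrix.one_mulVec, ← (Equiv.funUnique (Fin 1) V).symm.sum_comp]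
    simp [pathProb]
  | succ k ih =>
    rw [pow_succ', ← Matrix.mulVec_mulVec, ← (Fin.consEquiv fun _ => V).sum_comp,
      Fintype.sum_prod_type, Matrix.mulVec, dotProduct]
    simp only [← ih, Finset.mul_sum]
    rw [Finset.sum_eq_single x, Finset.sum_comm]
    · refine Finset.sum_congr rfl fun p _ => ?_
      rw [Finset.sum_eq_single (p 0)]
      · simp only [Fin.consEquiv, Equiv.coe_fn_mk, Fin.cons_zero, if_true, pathProb,
          Fin.prod_univ_succ, Fin.castSucc_zero, Fin.cons_succ, ← Fin.succ_last,
          ← Fin.succ_castSucc]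
        ring
      · intro z _ hz
        simp [Ne.symm hz]
      · simp
    · intro z _ hz
      refine Finset.sum_eq_zero fun p _ => ?_
      simp [Fin.consEquiv, hz]
    · simp

lemma hitByTime_eq (P : Matrix V V ℝ) (B : Finset V) (x : V) (r : ℕ) :
    hitByTime P B x r = ∑ k ∈ range r, ∑ y ∈ B, (killed P B ^ k) x y := by
  unfold hitByTime
  refine Finset.sum_congr rfl fun k _ => ?_
  have h := sum_pathProb (killed P B) (fun y => if y ∈ B then 1 else 0) k x
  simp only [Matrix.mulVec, dotProduct, mul_ite, mul_one, mul_zero, pathProb_killed] at h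
  have hB : ∑ y ∈ B, (killed P B ^ k) x y = ∑ y, if y ∈ B then (killed P B ^ k) x y else 0 := by
    simp
  rw [hB, ← h]
  refine Finset.sum_congr rfl fun p _ => ?_
  by_cases h1 : p 0 = x <;> by_cases h2 : p (Fin.last k) ∈ B <;> simp [h1, h2]

/-- The mass surviving the killing is the probability of not having hit `B`. -/
lemma sum_killed_pow {P : Matrix V V ℝ} (hP : IsStoch P) (B : Finset V) (x : V) (r : ℕ) :
    ∑ y, (killed P B ^ r) x y = 1 - hitByTime P B x r := by
  rw [hitByTime_eq]
  induction r with
  | zero => simp [Matrix.one_apply]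
  | succ r ih =>
    rw [Finset.sum_range_succ, ← sub_sub, ← ih]
    simp only [pow_succ, Matrix.mul_apply]
    rw [Finset.sum_comm, ← Finset.sum_compl_add_sum B (fun y => (killed P B ^ r) x y),
      add_sub_cancel_right, ← Finset.sum_compl_add_sum B]
    rw [Finset.sum_eq_zero (s := B), add_zero]
    · refine Finset.sum_congr rfl fun z hz => ?_
      have hz' := Finset.mem_compl.1 hz
      simp [← Finset.mul_sum, killed, hz', hP.2]
    · intro z hz
      simp [killed, hz]

lemma killed_nonneg {P : Matrix V V ℝ} (hP : IsStoch P) (B : Finset V) (a b : V) :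
    0 ≤ killed P B a b := by
  simp only [killed, Matrix.of_apply]
  split_ifs
  · exact le_rfl
  · exact hP.1 a b

lemma killed_pow_le {P : Matrix V V ℝ} (hP : IsStoch P) (B : Finset V) (r : ℕ) (x y : V) :
    (killed P B ^ r) x y ≤ (P ^ r) x y := by
  induction r generalizing x with
  | zero => simp
  | succ r ih =>
    rw [pow_succ', pow_succ', Matrix.mul_apply, Matrix.mul_apply]
    refine Finset.sum_le_sum fun z _ => ?_
    have h1 : killed P B x z ≤ P x z := by
      simp only [killed, Matrix.of_apply]
      split_ifs
      · exact hP.1 x z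
      · exact le_rfl
    exact (mul_le_mul_of_nonneg_left (ih z) (killed_nonneg hP B x z)).trans
      (mul_le_mul_of_nonneg_right h1 ((hP.pow r).1 z y))

/-- If `P'` on `A` agrees with `P` off the boundary set `B`, it dominates the killed chain. -/
lemma killed_pow_le_of_agree {P : Matrix V V ℝ} {A B : Finset V}
    {P' : Matrix {a // a ∈ A} {a // a ∈ A} ℝ} (hP' : IsStoch P')
    (hagree : ∀ a b : {a // a ∈ A}, a.1 ∉ B → P a.1 b.1 = P' a b)
    (hout : ∀ a ∈ A, a ∉ B → ∀ b ∉ A, P a b = 0) (r : ℕ) (x : {a // a ∈ A}) (y : V) :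
    (killed P B ^ r) x.1 y ≤ if h : y ∈ A then (P' ^ r) x ⟨y, h⟩ else 0 := by
  induction r generalizing x with
  | zero =>
    rw [pow_zero, pow_zero]
    by_cases h : y ∈ A
    · simp [h, Matrix.one_apply, Subtype.ext_iff]
    · have : x.1 ≠ y := fun hxy => h (hxy ▸ x.2)
      simp [h, this]
  | succ r ih =>
    by_cases hx : x.1 ∈ B
    · have h0 : (killed P B ^ (r + 1)) x.1 y = 0 := by
        rw [pow_succ', Matrix.mul_apply]
        exact Finset.sum_eq_zero fun z _ => by simp [killed, hx]
      rw [h0]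
      split_ifs
      · exact (hP'.pow _).1 _ _
      · exact le_rfl
    · have h1 : (killed P B ^ (r + 1)) x.1 y =
          ∑ z : {a // a ∈ A}, P' x z * (killed P B ^ r) z.1 y := by
        rw [pow_succ', Matrix.mul_apply,
          ← Finset.sum_compl_add_sum A (fun z => killed P B x.1 z * (killed P B ^ r) z y),
          Finset.sum_eq_zero, zero_add, ← Finset.sum_coe_sort]
        · refine Finset.sum_congr rfl fun z _ => ?_
          simp [killed, hx, hagree x z hx]
        · intro z hz
          simp [killed, hx, hout x.1 x.2 hx z (Finset.mem_compl.1 hz)]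
      rw [h1]
      refine (Finset.sum_le_sum fun z _ => mul_le_mul_of_nonneg_left (ih z) (hP'.1 x z)).trans
        (le_of_eq ?_)
      by_cases h : y ∈ A
      · simp [h, pow_succ', Matrix.mul_apply]
      · simp [h]

end Killing

lemma sum_dite_mem (A : Finset V) (f : {a // a ∈ A} → ℝ) :
    ∑ y, (if h : y ∈ A then f ⟨y, h⟩ else 0) = ∑ a, f a := by
  rw [← Finset.sum_compl_add_sum A, Finset.sum_eq_zero, zero_add, ← Finset.sum_coe_sort]
  · exact Finset.sum_congr rfl fun a _ => by simp
  · intro y hy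
    simp [Finset.mem_compl.1 hy]

/-- Chaining the comparisons along `p ≥ q ≤ p'`, `p' ≈ π'` and `π' ≈ π`. -/
lemma tvDist_le_of_chain {p q p' π' π : V → ℝ} {G : Finset V} {δ : ℝ}
    (hp : ∑ y, p y = 1) (hp' : ∑ y, p' y = 1) (hπ' : ∑ y, π' y = 1) (hπ : ∑ y, π y = 1)
    (hπ'0 : ∀ y, 0 ≤ π' y) (hπ0 : ∀ y, 0 ≤ π y)
    (hqp : ∀ y, q y ≤ p y) (hqp' : ∀ y, q y ≤ p' y) (hq : 1 - δ ≤ ∑ y, q y)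
    (hmix : tvDist p' π' ≤ δ) (hG : ∀ y ∈ G, π y ≤ π' y) (hGπ : 1 - δ ≤ ∑ y ∈ G, π y) :
    tvDist p π ≤ 3 * δ := by
  unfold tvDist at *
  have hpt : ∀ y, |p y - π y| ≤ (p y - q y) + (p' y - q y) + |p' y - π' y| +
      (π' y - π y + 2 * if y ∈ G then 0 else π y) := fun y => by
    have h1 : |p y - π y| ≤ |p y - q y| + |q y - p' y| + |p' y - π' y| + |π' y - π y| := by
      have e : p y - π y = (p y - q y) + (q y - p' y) + (p' y - π' y) + (π' y - π y) := by ring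
      rw [e]
      exact (abs_add_le _ _).trans (add_le_add_left ((abs_add_le _ _).trans
        (add_le_add_left (abs_add_le _ _) _)) _)
    have h2 : |p y - q y| = p y - q y := abs_of_nonneg (sub_nonneg.2 (hqp y))
    have h3 : |q y - p' y| = p' y - q y := by
      rw [abs_sub_comm]
      exact abs_of_nonneg (sub_nonneg.2 (hqp' y))
    have h4 : |π' y - π y| ≤ π' y - π y + 2 * if y ∈ G then 0 else π y := by
      split_ifs with hy
      · rw [abs_of_nonneg (sub_nonneg.2 (hG y hy))]
        linarith
      · rw [abs_le]
        constructor <;> linarith [hπ'0 y, hπ0 y]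
    linarith
  have hsum := Finset.sum_le_sum fun y (_ : y ∈ univ) => hpt y
  have hout : ∑ y, (if y ∈ G then 0 else π y) = 1 - ∑ y ∈ G, π y := by
    rw [← hπ, ← Finset.sum_compl_add_sum G π, add_sub_cancel_right, ← Finset.sum_compl_add_sum G,
      Finset.sum_eq_zero (s := G), add_zero]
    · exact Finset.sum_congr rfl fun y hy => by simp [Finset.mem_compl.1 hy]
    · intro y hy
      simp [hy]
  simp only [Finset.sum_add_distrib, Finset.sum_sub_distrib, ← Finset.mul_sum, hout, hp, hp', hπ',
    hπ] at hsum
  linarith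

/-- **Proposition 6.4.** Mixing from escape probabilities: if `π(Ã) ≥ 1 - ε/3`, the induced
chain on `A` has Cheeger constant `c`, `r = ⌈(2/c²) log (3D|A|/(2ε))⌉`, and `x ∈ Ã` satisfies
`P_x[T_{∂_V A} < r] ≤ ε/3`, then `‖P^r(x,·) - π‖_TV ≤ ε`. -/
theorem mixing_from_escape_probability
    {N : ℕ} (G : SimpleGraph (Fin N))
    (w : Fin N → Fin N → ℝ) (hw : GoodWeights G w)
    (D : ℝ) (hdeg : ∀ v, 1 ≤ ∑ u, w v u ∧ ∑ u, w v u ≤ D)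
    (ε : ℝ) (hε0 : 0 < ε) (hε1 : ε < 1)
    (A : Finset (Fin N))
    (bdry : Finset (Fin N))
    (hbdry : ∀ a, a ∈ bdry ↔ a ∈ A ∧ ∃ b, b ∉ A ∧ G.Adj a b)
    (hA : 1 - ε/3 ≤ ∑ a ∈ A \ bdry, wSta w a)
    (hind : Irred (indMat w A))
    (c : ℝ) (hcpos : 0 < c) (hc : c = cheeger (indMat w A) (indSta w A))
    (r : ℕ) (hr : r = ⌈(2 / c ^ 2) * Real.log (3 * D * (A.card : ℝ) / (2 * ε))⌉₊)
    (x : Fin N) (hx : x ∈ A \ bdry)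
    (hhit : hitByTime (wMat w) bdry x r ≤ ε / 3) :
    tvDist ((wMat w ^ r) x) (wSta w) ≤ ε := by
  obtain ⟨hs, hwpos, hw0⟩ := hw
  have hl : ∀ v, w v v = 0 := fun v => hw0 v v (G.loopless.irrefl v)
  have hnn : ∀ u v, 0 ≤ w u v := fun u v => by
    by_cases h : G.Adj u v
    · exact (hwpos u v h).le
    · exact (hw0 u v h).ge
  have hd : ∀ v, 0 < ∑ u, w v u := fun v => one_pos.trans_le (hdeg v).1
  have hP := isStoch_wMat hnn hl hd
  have hnbd : ∀ a ∈ A, a ∉ bdry → ∀ b ∉ A, w a b = 0 := fun a ha hab b hb =>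
    hw0 a b fun hadj => hab ((hbdry a).2 ⟨ha, b, hb, hadj⟩)
  have hdegA : ∀ a ∈ A, a ∉ bdry → ∑ b : {a // a ∈ A}, w a b.1 = ∑ b, w a b :=
    fun a ha hab => by
      rw [← Finset.sum_compl_add_sum A (fun b => w a b), Finset.sum_eq_zero (s := Aᶜ), zero_add,
        Finset.sum_coe_sort A (fun b => w a b)]
      exact fun b hb => hnbd a ha hab b (Finset.mem_compl.1 hb)
  obtain ⟨hxA, hxB⟩ := Finset.mem_sdiff.1 hx
  -- the induced network
  set w' : {a // a ∈ A} → {a // a ∈ A} → ℝ := fun a b => w a.1 b.1 with hw'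
  have hmat : indMat w A = wMat w' := rfl
  have hsta : indSta w A = wSta w' := rfl
  set x' : {a // a ∈ A} := ⟨x, hxA⟩ with hx'
  have hs' : ∀ a b, w' a b = w' b a := fun a b => hs _ _
  have hnn' : ∀ a b, 0 ≤ w' a b := fun a b => hnn _ _
  have hl' : ∀ a, w' a a = 0 := fun a => hl _
  have hdx : ∑ b, w' x' b = ∑ b, w x b := hdegA x hxA hxB
  have hd' : ∀ a, 0 < ∑ b, w' a b :=
    sum_pos_of_irred hnn' (hmat ▸ hind) (x := x') (hdx ▸ hd x)
  have hP' := isStoch_wMat hnn' hl' hd'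
  have hdle : ∀ a, ∑ b, w' a b ≤ ∑ b, w a.1 b := fun a => by
    rw [hw', Finset.sum_coe_sort A (fun b => w a.1 b)]
    exact Finset.sum_le_sum_of_subset_of_nonneg (Finset.subset_univ A) fun b _ _ => hnn _ _
  have hM' : 0 < ∑ a, ∑ b, w' a b := Finset.sum_pos (fun a _ => hd' a) ⟨x', mem_univ _⟩
  have hM : 0 < ∑ a, ∑ b, w a b := Finset.sum_pos (fun a _ => hd a) ⟨x, mem_univ _⟩
  have hMle : ∑ a, ∑ b, w' a b ≤ ∑ a, ∑ b, w a b := by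
    refine (Finset.sum_le_sum fun a _ => hdle a).trans ?_
    rw [Finset.sum_coe_sort A (fun a => ∑ b, w a b)]
    exact Finset.sum_le_sum_of_subset_of_nonneg (Finset.subset_univ A) fun a _ _ => (hd a).le
  have hMD : ∑ a, ∑ b, w' a b ≤ D * A.card := by
    refine (Finset.sum_le_sum fun a _ => (hdle a).trans (hdeg a.1).2).trans (le_of_eq ?_)
    simp [mul_comm]
  -- mixing of the induced chain
  have hmix : ∑ y, |(wMat w' ^ r) x' y - wSta w' y| ≤ 2 * (ε / 3) := by
    rw [hmat, hsta] at hc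
    have hsq := sum_abs_pow_sub_sq_le hs' hnn' hl' hd' hcpos.le
      (fun S hS => hc ▸ cheeger_isoperimetric hnn' hd' S hS) x' r
    have hcard : (1 : ℝ) ≤ A.card := by exact_mod_cast Finset.card_pos.2 ⟨x, hxA⟩
    have hD : 1 ≤ D := (hdeg x).1.trans (hdeg x).2
    set K := D * (A.card : ℝ) with hK
    have hK1 : 1 ≤ K := one_le_mul_of_one_le_of_one_le hD hcard
    have hK0 : 0 < K := one_pos.trans_le hK1
    have hr' : 2 / c ^ 2 * Real.log (3 * K / (2 * ε)) ≤ r := by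
      rw [hr, hK, ← mul_assoc]
      exact Nat.le_ceil _
    have hexp : Real.exp (-(c ^ 2 * r)) ≤ (2 * ε / (3 * K)) ^ 2 := by
      have h1 : 2 * Real.log (3 * K / (2 * ε)) ≤ c ^ 2 * r := by
        rw [div_mul_eq_mul_div, div_le_iff₀ (by positivity)] at hr'
        linarith
      have h2 : (2 * ε / (3 * K)) ^ 2 = Real.exp (-(2 * Real.log (3 * K / (2 * ε)))) := by
        rw [← inv_div, Real.exp_neg, two_mul (Real.log _), Real.exp_add,
          Real.exp_log (by positivity), inv_pow, sq]
      rw [h2]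
      exact Real.exp_le_exp.2 (neg_le_neg h1)
    have hratio : (∑ a, ∑ b, w' a b) / (∑ b, w' x' b) ≤ K :=
      (div_le_self hM'.le (hdx ▸ (hdeg x).1)).trans hMD
    refine abs_le_of_sq_le_sq' (hsq.trans ?_) (by positivity) |>.2
    calc _ ≤ K * (2 * ε / (3 * K)) ^ 2 :=
          mul_le_mul hratio hexp (Real.exp_pos _).le hK0.le
      _ = (2 * (ε / 3)) ^ 2 / K := by field_simp
      _ ≤ (2 * (ε / 3)) ^ 2 := div_le_self (sq_nonneg _) hK1
  have hπ'1 : ∑ a, wSta w' a = 1 := by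
    simp only [wSta]
    rw [← Finset.sum_div, div_self hM'.ne']
  have hπ1 : ∑ a, wSta w a = 1 := by
    simp only [wSta]
    rw [← Finset.sum_div, div_self hM.ne']
  have hagree : ∀ a b : {a // a ∈ A}, a.1 ∉ bdry → wMat w a.1 b.1 = wMat w' a b :=
    fun a b ha => by
      simp only [wMat, Matrix.of_apply, Subtype.ext_iff, hw', hdegA a.1 a.2 ha]
  have hout : ∀ a ∈ A, a ∉ bdry → ∀ b ∉ A, wMat w a b = 0 := fun a ha hab b hb => by
    have hne : a ≠ b := fun h => hb (h ▸ ha)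
    simp [wMat, hne, hnbd a ha hab b hb]
  have hfin := tvDist_le_of_chain (p := (wMat w ^ r) x) (q := (killed (wMat w) bdry ^ r) x)
    (p' := fun y => if h : y ∈ A then (wMat w' ^ r) x' ⟨y, h⟩ else 0)
    (π' := fun y => if h : y ∈ A then wSta w' ⟨y, h⟩ else 0) (π := wSta w)
    (G := A \ bdry) (δ := ε / 3) ((hP.pow r).2 x)
    ((sum_dite_mem A fun y => (wMat w' ^ r) x' y).trans ((hP'.pow r).2 x'))
    ((sum_dite_mem A _).trans hπ'1) hπ1
    (fun y => by
      split_ifs with h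
      · exact div_nonneg (hd' _).le hM'.le
      · exact le_rfl)
    (fun y => div_nonneg (hd y).le hM.le)
    (killed_pow_le hP bdry r x)
    (killed_pow_le_of_agree hP' hagree hout r x')
    (by rw [sum_killed_pow hP]; linarith)
    (by
      have h1 : ∀ y, |(if h : y ∈ A then (wMat w' ^ r) x' ⟨y, h⟩ else 0) -
          (if h : y ∈ A then wSta w' ⟨y, h⟩ else 0)| =
          if h : y ∈ A then |(wMat w' ^ r) x' ⟨y, h⟩ - wSta w' ⟨y, h⟩| else 0 := fun y => by
        split_ifs <;> simp
      unfold tvDist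
      rw [Finset.sum_congr rfl fun y _ => h1 y,
        sum_dite_mem A fun y => |(wMat w' ^ r) x' y - wSta w' y|]
      linarith)
    (fun y hy => by
      obtain ⟨hyA, hyB⟩ := Finset.mem_sdiff.1 hy
      have h1 : ∑ b, w' ⟨y, hyA⟩ b = ∑ b, w y b := hdegA y hyA hyB
      simp only [hyA, dif_pos, wSta, h1]
      exact div_le_div_of_nonneg_left (hd y).le hM' hMle)
    hA
  linarith

end
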